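/- Let φ : ℝ³ → ℝ be a smooth graphical translator, i.e. Θ[φ] = 0. Then at every point of ℝ³ one has the exact identity L_φ(log H_φ) = −|Hess φ|²/(1+|Dφ|²)^{3/2} + 3|Hess φ · Dφ|²/(1+|Dφ|²)^{5/2} − 2(Hess φ(Dφ,Dφ))²/(1+|Dφ|²)^{7/2}, where |Hess φ|² denotes the squared Frobenius norm of the Hessian and Hess φ · Dφ the matrix–vector product. (Note log H_φ = −(1/2)log(1+|Dφ|²).) -/

import Mathlib

open Real

noncomputable section

/-- Euclidean 3-space. -/
abbrev E3 : Type := EuclideanSpace ℝ (Fin 3)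

/-- The point (a,b,c) ∈ ℝ³. -/
def mk3 (a b c : ℝ) : E3 := (WithLp.equiv 2 (Fin 3 → ℝ)).symm ![a, b, c]

/-- Partial derivative in the i-th coordinate direction. -/
def pd (i : Fin 3) (f : E3 → ℝ) (x : E3) : ℝ := fderiv ℝ f x (EuclideanSpace.single i 1)

/-- Squared norm of the gradient, |Dφ|². -/
def gradSq (φ : E3 → ℝ) (x : E3) : ℝ := ∑ i, (pd i φ x) ^ 2

/-- Divergence of a vector field on ℝ³, given componentwise. -/
def divg (F : Fin 3 → E3 → ℝ) (x : E3) : ℝ := ∑ i, pd i (F i) x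

/-- Mean curvature of graph(φ): H_φ = 1/√(1+|Dφ|²). -/
def Hmc (φ : E3 → ℝ) (x : E3) : ℝ := 1 / sqrt (1 + gradSq φ x)

/-- The translator operator Θ[φ] = div(Dφ/√(1+|Dφ|²)) − 1/√(1+|Dφ|²). -/
def Θop (φ : E3 → ℝ) (x : E3) : ℝ :=
  divg (fun i y => pd i φ y / sqrt (1 + gradSq φ y)) x - 1 / sqrt (1 + gradSq φ x)

/-- The linearized translator operator L_φ u = div(a_φ Du) + b_φ · Du. -/
def Lop (φ u : E3 → ℝ) (x : E3) : ℝ :=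
  divg (fun i y => ∑ j, ((if i = j then (1:ℝ) else 0) / sqrt (1 + gradSq φ y)
        - pd i φ y * pd j φ y / (1 + gradSq φ y) ^ ((3:ℝ)/2)) * pd j u y) x
  + ∑ i, pd i φ x * pd i u x / (1 + gradSq φ x) ^ ((3:ℝ)/2)

/-- Entries of the Hessian of φ. -/
def hess (φ : E3 → ℝ) (x : E3) (i j : Fin 3) : ℝ := pd i (pd j φ) x

/-- Partial derivatives of a smooth function are smooth. -/
lemma contDiff_pd {f : E3 → ℝ} (hf : ContDiff ℝ (⊤ : ℕ∞) f) (i : Fin 3) :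
    ContDiff ℝ (⊤ : ℕ∞) (pd i f) := by
  unfold pd
  exact (hf.fderiv_right (m := (⊤ : ℕ∞)) (by norm_cast)).clm_apply contDiff_const

/-- Along the `i`-th coordinate line, a smooth function has derivative `pd i f x`. -/
lemma hasDerivAt_line {f : E3 → ℝ} (hf : ContDiff ℝ (⊤ : ℕ∞) f) (i : Fin 3) (x : E3) :
    HasDerivAt (fun t : ℝ => f (x + t • EuclideanSpace.single i (1 : ℝ))) (pd i f x) 0 := by
  have h : HasFDerivAt f (fderiv ℝ f x) x :=
    (hf.differentiable (by simp)).differentiableAt.hasFDerivAt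
  exact h.hasLineDerivAt (EuclideanSpace.single i (1 : ℝ))

/-- The partial derivative of a smooth function is computed along a coordinate line. -/
lemma pd_eq_of_hasDerivAt_line {f : E3 → ℝ} (hf : ContDiff ℝ (⊤ : ℕ∞) f) {i : Fin 3} {x : E3}
    {d : ℝ} (h : HasDerivAt (fun t : ℝ => f (x + t • EuclideanSpace.single i (1 : ℝ))) d 0) :
    pd i f x = d :=
  (hasDerivAt_line hf i x).unique h

/-- Partial derivatives of smooth functions commute. -/
lemma pd_comm {f : E3 → ℝ} (hf : ContDiff ℝ (⊤ : ℕ∞) f) (i j : Fin 3) :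
    pd i (pd j f) = pd j (pd i f) := by
  funext x
  have hd : DifferentiableAt ℝ (fderiv ℝ f) x :=
    ((hf.fderiv_right (m := (⊤ : ℕ∞)) (by norm_cast)).differentiable (by simp)).differentiableAt
  have key : ∀ v w : E3, fderiv ℝ (fun y => fderiv ℝ f y v) x w = fderiv ℝ (fderiv ℝ f) x w v := by
    intro v w
    rw [fderiv_clm_apply hd (differentiableAt_const v)]
    simp
  have hs : IsSymmSndFDerivAt ℝ f x :=
    hf.contDiffAt.isSymmSndFDerivAt (by
      rw [minSmoothness_of_isRCLikeNormedField]
      exact WithTop.coe_le_coe.2 (le_top : (2 : ℕ∞) ≤ ⊤))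
  unfold pd
  rw [key, key]
  exact hs _ _

lemma gradSq_add_one_pos (φ : E3 → ℝ) (x : E3) : 0 < 1 + gradSq φ x := by
  unfold gradSq
  positivity

lemma Hmc_pos (φ : E3 → ℝ) (x : E3) : 0 < Hmc φ x :=
  one_div_pos.2 (sqrt_pos.2 (gradSq_add_one_pos φ x))

lemma contDiff_Hmc {φ : E3 → ℝ} (hφ : ContDiff ℝ (⊤ : ℕ∞) φ) :
    ContDiff ℝ (⊤ : ℕ∞) (Hmc φ) := by
  have hW : ContDiff ℝ (⊤ : ℕ∞) (fun y => 1 + gradSq φ y) := by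
    unfold gradSq
    exact contDiff_const.add (ContDiff.sum fun i _ => (contDiff_pd hφ i).pow 2)
  exact contDiff_const.div (hW.sqrt fun y => (gradSq_add_one_pos φ y).ne')
    fun y => (sqrt_pos.2 (gradSq_add_one_pos φ y)).ne'

/-- Division by a half-integer power of `1 + |Dφ|²` is multiplication by a power of `H_φ`. -/
lemma div_rpow_eq_mul_Hmc_pow (φ : E3 → ℝ) (x : E3) (n : ℕ) (a : ℝ) :
    a / (1 + gradSq φ x) ^ ((n : ℝ) / 2) = a * Hmc φ x ^ n := by
  have hW := gradSq_add_one_pos φ x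
  rw [Hmc, div_eq_mul_inv, one_div, inv_pow, sqrt_eq_rpow, ← rpow_natCast, ← rpow_mul hW.le]
  congr 3
  ring

/-- The gradient of the mean curvature: `DH = -H³ Hess φ · Dφ`. -/
lemma pd_Hmc {φ : E3 → ℝ} (hφ : ContDiff ℝ (⊤ : ℕ∞) φ) (k : Fin 3) (x : E3) :
    pd k (Hmc φ) x = -Hmc φ x ^ 3 * ∑ j, hess φ x k j * pd j φ x := by
  have hp := fun j => hasDerivAt_line (contDiff_pd hφ j) k x
  have hs := hasDerivAt_line (contDiff_Hmc hφ) k x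
  have hconst : ∀ y, Hmc φ y ^ 2 * (1 + ∑ i, pd i φ y ^ 2) = 1 := by
    intro y
    have hW := gradSq_add_one_pos φ y
    rw [Hmc, div_pow, sq_sqrt hW.le, ← gradSq]
    field_simp
  have hd := (hs.pow 2).mul ((HasDerivAt.fun_sum (u := Finset.univ)
    fun j _ => (hp j).pow 2).const_add 1)
  have h0 := hd.unique ((hasDerivAt_const (0 : ℝ) (1 : ℝ)).congr_of_eventuallyEq
    (Filter.Eventually.of_forall fun t => hconst _))
  have hx := hconst x
  simp only [Fin.sum_univ_three, hess, zero_smul, add_zero, Pi.pow_apply] at h0 hx ⊢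
  push_cast at h0
  linear_combination (Hmc φ x / 2) * h0 - pd k (Hmc φ) x * hx

/-- The non-divergence form `Δφ - H² Hess φ(Dφ, Dφ) = 1` of the translator equation. -/
lemma laplacian_eq_of_translator {φ : E3 → ℝ} (hφ : ContDiff ℝ (⊤ : ℕ∞) φ)
    (hsol : ∀ x, Θop φ x = 0) (x : E3) :
    ∑ i, hess φ x i i
      = 1 + (∑ i, ∑ j, hess φ x i j * pd i φ x * pd j φ x) * Hmc φ x ^ 2 := by
  have hdiv : ∀ i, pd i (fun y => pd i φ y / sqrt (1 + gradSq φ y)) x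
      = hess φ x i i * Hmc φ x
        + pd i φ x * (-Hmc φ x ^ 3 * ∑ j, hess φ x i j * pd j φ x) := by
    intro i
    have he : (fun y => pd i φ y / sqrt (1 + gradSq φ y)) = fun y => pd i φ y * Hmc φ y := by
      funext y
      rw [Hmc, mul_one_div]
    rw [he, ← pd_Hmc hφ]
    have hc := (contDiff_pd hφ i).mul (contDiff_Hmc hφ)
    have hd := (hasDerivAt_line (contDiff_pd hφ i) i x).mul
      (hasDerivAt_line (contDiff_Hmc hφ) i x)
    have := pd_eq_of_hasDerivAt_line hc hd
    simpa [hess] using this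
  have h := hsol x
  simp only [Θop, divg, hdiv] at h
  rw [← Hmc] at h
  apply mul_left_cancel₀ (Hmc_pos φ x).ne'
  simp only [Fin.sum_univ_three] at h ⊢
  linear_combination h

/-- The gradient of `log H_φ` is `-H² Hess φ · Dφ`. -/
lemma pd_log_Hmc {φ : E3 → ℝ} (hφ : ContDiff ℝ (⊤ : ℕ∞) φ) (k : Fin 3) (x : E3) :
    pd k (fun y => log (Hmc φ y)) x = -Hmc φ x ^ 2 * ∑ j, hess φ x k j * pd j φ x := by
  have hH := (Hmc_pos φ x).ne'
  have hd := (hasDerivAt_line (contDiff_Hmc hφ) k x).log (by simpa using hH)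
  rw [pd_eq_of_hasDerivAt_line ((contDiff_Hmc hφ).log fun y => (Hmc_pos φ y).ne') hd,
    pd_Hmc hφ]
  simp only [zero_smul, add_zero]
  field_simp

/-- for a smooth graphical translator φ one has the exact identity
L_φ(log H_φ) = −|Hess φ|²/(1+|Dφ|²)^{3/2} + 3|Hess φ·Dφ|²/(1+|Dφ|²)^{5/2}
               − 2(Hess φ(Dφ,Dφ))²/(1+|Dφ|²)^{7/2}. -/
theorem statement1 (φ : E3 → ℝ) (hφ : ContDiff ℝ (⊤ : ℕ∞) φ)
    (hsol : ∀ x, Θop φ x = 0) (x : E3) :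
    Lop φ (fun y => log (Hmc φ y)) x =
      - (∑ i, ∑ j, (hess φ x i j) ^ 2) / (1 + gradSq φ x) ^ ((3:ℝ)/2)
      + 3 * (∑ i, (∑ j, hess φ x i j * pd j φ x) ^ 2) / (1 + gradSq φ x) ^ ((5:ℝ)/2)
      - 2 * (∑ i, ∑ j, hess φ x i j * pd i φ x * pd j φ x) ^ 2
          / (1 + gradSq φ x) ^ ((7:ℝ)/2) := by
  have hp := contDiff_pd hφ
  have hH := contDiff_Hmc hφ
  have hh : ∀ i j, ContDiff ℝ (⊤ : ℕ∞) (fun y => hess φ y i j) := fun i j => contDiff_pd (hp j) i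
  have hQ : ContDiff ℝ (⊤ : ℕ∞) (fun y => ∑ i, ∑ j, hess φ y i j * pd i φ y * pd j φ y) :=
    ContDiff.sum fun i _ => ContDiff.sum fun j _ => ((hh i j).mul (hp i)).mul (hp j)
  have hV : ∀ i, ContDiff ℝ (⊤ : ℕ∞) (fun y => ∑ j, hess φ y i j * pd j φ y) :=
    fun i => ContDiff.sum fun j _ => (hh i j).mul (hp j)
  have r3 := div_rpow_eq_mul_Hmc_pow φ x 3
  have r5 := div_rpow_eq_mul_Hmc_pow φ x 5
  have r7 := div_rpow_eq_mul_Hmc_pow φ x 7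
  have r3' := fun y => div_rpow_eq_mul_Hmc_pow φ y 3
  push_cast at r3 r5 r7 r3'
  set T : Fin 3 → Fin 3 → Fin 3 → ℝ := fun k i j => pd k (fun y => hess φ y i j) x with hT
  have dp : ∀ k j, HasDerivAt (fun t : ℝ => pd j φ (x + t • EuclideanSpace.single k (1 : ℝ)))
      (hess φ x k j) 0 := fun k j => hasDerivAt_line (hp j) k x
  have dh : ∀ k i j, HasDerivAt
      (fun t : ℝ => hess φ (x + t • EuclideanSpace.single k (1 : ℝ)) i j) (T k i j) 0 :=
    fun k i j => hasDerivAt_line (hh i j) k x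
  have dH : ∀ k, HasDerivAt (fun t : ℝ => Hmc φ (x + t • EuclideanSpace.single k (1 : ℝ)))
      (-Hmc φ x ^ 3 * ∑ j, hess φ x k j * pd j φ x) 0 := by
    intro k
    rw [← pd_Hmc hφ]
    exact hasDerivAt_line hH k x
  have dV : ∀ k i, HasDerivAt (fun t : ℝ => ∑ j,
      hess φ (x + t • EuclideanSpace.single k (1 : ℝ)) i j
        * pd j φ (x + t • EuclideanSpace.single k (1 : ℝ)))
      (∑ j, (T k i j * pd j φ x + hess φ x i j * hess φ x k j)) 0 := by
    intro k i
    refine HasDerivAt.fun_sum fun j _ => ?_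
    simpa using (dh k i j).fun_mul (dp k j)
  have dQ : ∀ k, HasDerivAt (fun t : ℝ => ∑ i, ∑ j,
      hess φ (x + t • EuclideanSpace.single k (1 : ℝ)) i j
        * pd i φ (x + t • EuclideanSpace.single k (1 : ℝ))
        * pd j φ (x + t • EuclideanSpace.single k (1 : ℝ)))
      (∑ i, ∑ j, ((T k i j * pd i φ x + hess φ x i j * hess φ x k i) * pd j φ x
        + hess φ x i j * pd i φ x * hess φ x k j)) 0 := by
    intro k
    refine HasDerivAt.fun_sum fun i _ => HasDerivAt.fun_sum fun j _ => ?_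
    simpa using ((dh k i j).fun_mul (dp k i)).fun_mul (dp k j)
  have heq := laplacian_eq_of_translator hφ hsol
  have hdeq : ∀ k, ∑ i, T k i i
      = (∑ i, ∑ j, ((T k i j * pd i φ x + hess φ x i j * hess φ x k i) * pd j φ x
          + hess φ x i j * pd i φ x * hess φ x k j)) * Hmc φ x ^ 2
        + (∑ i, ∑ j, hess φ x i j * pd i φ x * pd j φ x)
          * (2 * Hmc φ x * (-Hmc φ x ^ 3 * ∑ j, hess φ x k j * pd j φ x)) := by
    intro k
    have h1 := HasDerivAt.fun_sum (u := Finset.univ) fun i _ => dh k i i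
    have h2 := ((dQ k).fun_mul ((dH k).fun_pow 2)).const_add 1
    have := h1.unique (h2.congr_of_eventuallyEq (Filter.Eventually.of_forall fun t => heq _))
    simpa using this
  have hflux : ∀ i, pd i (fun y => ∑ j, ((if i = j then (1:ℝ) else 0) / sqrt (1 + gradSq φ y)
        - pd i φ y * pd j φ y / (1 + gradSq φ y) ^ ((3:ℝ)/2))
          * pd j (fun z => log (Hmc φ z)) y) x
      = -(3 * Hmc φ x ^ 2 * (-Hmc φ x ^ 3 * ∑ j, hess φ x i j * pd j φ x)
            * (∑ j, hess φ x i j * pd j φ x)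
          + Hmc φ x ^ 3 * ∑ j, (T i i j * pd j φ x + hess φ x i j * hess φ x i j))
        + ((hess φ x i i * (∑ a, ∑ b, hess φ x a b * pd a φ x * pd b φ x)
            + pd i φ x * (∑ a, ∑ b, ((T i a b * pd a φ x + hess φ x a b * hess φ x i a) * pd b φ x
              + hess φ x a b * pd a φ x * hess φ x i b))) * Hmc φ x ^ 5
          + pd i φ x * (∑ a, ∑ b, hess φ x a b * pd a φ x * pd b φ x)
            * (5 * Hmc φ x ^ 4 * (-Hmc φ x ^ 3 * ∑ j, hess φ x i j * pd j φ x))) := by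
    intro i
    have he : (fun y => ∑ j, ((if i = j then (1:ℝ) else 0) / sqrt (1 + gradSq φ y)
        - pd i φ y * pd j φ y / (1 + gradSq φ y) ^ ((3:ℝ)/2))
          * pd j (fun z => log (Hmc φ z)) y)
        = fun y => -(Hmc φ y ^ 3 * ∑ j, hess φ y i j * pd j φ y)
          + pd i φ y * (∑ a, ∑ b, hess φ y a b * pd a φ y * pd b φ y) * Hmc φ y ^ 5 := by
      funext y
      have hdiv : ∀ c, c / sqrt (1 + gradSq φ y) = c * Hmc φ y := fun c => by
        rw [Hmc, mul_one_div]
      simp only [r3', hdiv, pd_log_Hmc hφ]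
      fin_cases i <;> simp [Fin.sum_univ_three] <;> ring
    rw [he]
    have hc : ContDiff ℝ (⊤ : ℕ∞) (fun y => -(Hmc φ y ^ 3 * ∑ j, hess φ y i j * pd j φ y)
          + pd i φ y * (∑ a, ∑ b, hess φ y a b * pd a φ y * pd b φ y) * Hmc φ y ^ 5) :=
      ((hH.pow 3).mul (hV i)).neg.add (((hp i).mul hQ).mul (hH.pow 5))
    have hd := (((dH i).fun_pow 3).fun_mul (dV i i)).fun_neg.fun_add
      (((dp i i).fun_mul (dQ i)).fun_mul ((dH i).fun_pow 5))
    have := pd_eq_of_hasDerivAt_line hc hd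
    simpa using this
  have hsymm : ∀ y i j, hess φ y i j = hess φ y j i := fun y i j => congrFun (pd_comm hφ i j) y
  have hT1 : ∀ k i j, T k i j = T k j i := fun k i j => by
    simp only [hT, hsymm _ i j]
  have hT2 : ∀ k i j, T k i j = T i k j := fun k i j => congrFun (pd_comm (hp j) k i) x
  have hx := heq x
  have hd0 := hdeq 0
  have hd1 := hdeq 1
  have hd2 := hdeq 2
  clear_value T
  rw [Lop, divg, r3, r5, r7]
  simp only [hflux]
  simp only [r3, pd_log_Hmc hφ]
  simp only [Fin.sum_univ_three, hsymm x 1 0, hsymm x 2 0, hsymm x 2 1, hT2 1 0, hT2 2 0, hT2 2 1,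
    hT1 0 1 0, hT1 0 2 0, hT1 0 2 1, hT1 1 2 0, hT1 1 2 1, hT1 1 1 0, hT1 2 2 0, hT1 2 2 1]
    at hx hd0 hd1 hd2 ⊢
  linear_combination
    Hmc φ x ^ 5 * (hess φ x 0 0 * pd 0 φ x ^ 2 + hess φ x 1 1 * pd 1 φ x ^ 2
      + hess φ x 2 2 * pd 2 φ x ^ 2 + 2 * hess φ x 0 1 * pd 0 φ x * pd 1 φ x
      + 2 * hess φ x 0 2 * pd 0 φ x * pd 2 φ x + 2 * hess φ x 1 2 * pd 1 φ x * pd 2 φ x) * hx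
    - Hmc φ x ^ 3 * (pd 0 φ x * hd0 + pd 1 φ x * hd1 + pd 2 φ x * hd2)
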